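/- For every a,b,c ∈ ℝ, the two-dimensional (Hausdorff) measure of (Q \ M₁) ∩ S(a,b,c) is at most 5/9 times the two-dimensional (Hausdorff) measure of Q ∩ S(a,b,c), where Q = [0,1]³, S(a,b,c) = {(x,y,z) ∈ ℝ³ : ax + by + c = z}, and M₁ is the first approximation of the Menger sponge. -/

import Mathlib

open MeasureTheory Set ENNReal

/-- The lower-left corners of the seven level-one cubes removed in the construction of the
Menger sponge. -/
def removedVecs : Set (Fin 3 → ℝ) :=
  {![1/3, 1/3, 0], ![1/3, 0, 1/3], ![0, 1/3, 1/3], ![1/3, 1/3, 2/3],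
    ![1/3, 2/3, 1/3], ![2/3, 1/3, 1/3], ![1/3, 1/3, 1/3]}

/-- The 20 translation vectors of the Menger sponge IFS:
`{0, 1/3, 2/3}³` minus the seven removed vectors. -/
def mengerVecs : Set (Fin 3 → ℝ) :=
  {v | ∀ i, v i ∈ ({0, 1/3, 2/3} : Set ℝ)} \ removedVecs

/-- The unit cube `Q = [0,1]³` in Euclidean three-space. -/
def unitCube : Set (EuclideanSpace ℝ (Fin 3)) :=
  {x | ∀ i, x i ∈ Set.Icc (0 : ℝ) 1}

/-- The plane `S(a,b,c) = {(x,y,z) : ax + by + c = z}`. -/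
def Splane (a b c : ℝ) : Set (EuclideanSpace ℝ (Fin 3)) :=
  {x | a * x 0 + b * x 1 + c = x 2}

/-- `M₁`, the first approximation of the Menger sponge: the union of the 20 cubes
`t_i + [0,1/3]³` for `t_i` ranging over the Menger translation vectors. -/
def mengerFirstApprox : Set (EuclideanSpace ℝ (Fin 3)) :=
  {x | ∃ v ∈ mengerVecs, ∀ i, x i ∈ Set.Icc (v i) (v i + 1/3)}

theorem exists_hausdorffMeasure_image_linearMap_eq_const_mul {E : Type*}
    [NormedAddCommGroup E] [NormedSpace ℝ E] [MeasurableSpace E] [BorelSpace E]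
    (L : ℝ × ℝ →L[ℝ] E) (hL : Function.Injective L) (v : E) :
    ∃ k : ℝ≥0∞, ∀ A : Set (ℝ × ℝ), μH[2] ((fun u => v + L u) '' A) = k * volume A := by
  have hemb : MeasurableEmbedding L :=
    (LinearMap.isClosedEmbedding_of_injective (f := (L : ℝ × ℝ →ₗ[ℝ] E))
      (LinearMap.ker_eq_bot.2 hL)).measurableEmbedding
  let ν : Measure (ℝ × ℝ) := (μH[2] : Measure E).comap L
  have hν : ∀ A : Set (ℝ × ℝ), ν A = μH[2] (L '' A) := fun A => hemb.comap_apply _ A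
  have htrans : ∀ (w : E) (B : Set E), μH[2] ((fun x => w + x) '' B) = μH[2] B := fun w B =>
    (IsometryEquiv.addLeft w).hausdorffMeasure_image 2 B
  have : IsFiniteMeasureOnCompacts ν := ⟨fun K hK => by
    rw [hν]
    refine (L.lipschitz.hausdorffMeasure_image_le (by norm_num) K).trans_lt ?_
    rw [hausdorffMeasure_prod_real]
    exact ENNReal.mul_lt_top (by simp) hK.measure_lt_top⟩
  have : ν.IsAddLeftInvariant := by
    refine (forall_measure_preimage_add_iff ν).1 fun g A _ => ?_
    rw [hν, hν, ← htrans (L g) (L '' _), image_image]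
    congr 1
    simp_rw [← map_add]
    rw [← image_image L (fun x => g + x), image_preimage_eq _ (add_left_surjective g)]
  refine ⟨Measure.addHaarScalarFactor ν volume, fun A => ?_⟩
  rw [← image_image (fun x => v + x) L, htrans, ← hν]
  exact congrArg (· A) (Measure.isAddLeftInvariant_eq_smul ν volume)

theorem lintegral_eq_setLIntegral_add_shifts {g : ℝ → ℝ≥0∞} (hg : Measurable g)
    (h : ∀ t ∉ Icc (0 : ℝ) 3, g t = 0) :
    ∫⁻ t, g t = ∫⁻ t in Ioo (0 : ℝ) 1, (g t + g (t + 1) + g (t + 2)) := by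
  have hshift : ∀ p q r : ℝ, ∫⁻ t in Ioc p q, g (t + r) = ∫⁻ t in Ioc (p + r) (q + r), g t := by
    intro p q r
    rw [← (measurePreserving_add_right volume r).setLIntegral_comp_preimage measurableSet_Ioc hg]
    simp
  have hsplit : ∀ p q r : ℝ, p ≤ q → q ≤ r →
      ∫⁻ t in Ioc p r, g t = (∫⁻ t in Ioc p q, g t) + ∫⁻ t in Ioc q r, g t := by
    intro p q r hpq hqr
    rw [← Ioc_union_Ioc_eq_Ioc hpq hqr,
      lintegral_union measurableSet_Ioc (Ioc_disjoint_Ioc_of_le le_rfl)]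
  rw [← setLIntegral_eq_of_support_subset (s := Icc 0 3)
      (fun t ht => by_contra fun h' => ht (h t h')),
    setLIntegral_congr Ioc_ae_eq_Icc.symm, setLIntegral_congr Ioo_ae_eq_Ioc,
    lintegral_add_right _ (by fun_prop), lintegral_add_right _ (by fun_prop), hshift, hshift,
    hsplit 0 2 3 (by norm_num) (by norm_num), hsplit 0 1 2 (by norm_num) (by norm_num)]
  norm_num

/-- The contribution, at one end of a row outside the middle third, to the excess of `5/9` of the
row's length over its removed length, where `s` is the signed length cut off at that end
(up to a factor and a constant). -/
noncomputable def outerDeficit (s : ℝ) : ℝ := min 0 (max (-6) (9 - 5 * s))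
/-- The analogue of `outerDeficit` for a row in the middle third. -/
noncomputable def middleDeficit (s : ℝ) : ℝ := max 0 (min 12 (10 * s - 8))

theorem outerDeficit_add_middleDeficit_nonneg {s e : ℝ} (he : |e| ≤ 1) :
    0 ≤ outerDeficit (s + e) + middleDeficit s + outerDeficit (s - e) := by
  obtain ⟨h1, h2⟩ := abs_le.1 he
  unfold outerDeficit middleDeficit
  grind

theorem outerDeficit_le {u w : ℝ} (hw : 1 ≤ w) :
    9 * max 0 (min 2 (u + 2 * w) - max 1 (u + w)) + 6 + outerDeficit u + outerDeficit (3 - u - 3 * w) ≤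
      5 * max 0 (min 3 (u + 3 * w) - max 0 u) := by
  unfold outerDeficit
  grind

theorem middleDeficit_le {u w : ℝ} (hw : 1 ≤ w) :
    9 * (max 0 (min 2 (u + 3 * w) - max 1 u) + max 0 (min 3 (u + 2 * w) - max 0 (u + w)) -
      max 0 (min 2 (u + 2 * w) - max 1 (u + w))) - 12 + middleDeficit u + middleDeficit (3 - u - 3 * w) ≤
      5 * max 0 (min 3 (u + 3 * w) - max 0 u) := by
  unfold middleDeficit
  grind (splits := 30)

/-- The part of the line `z = α s + c` inside the square `[0,3]²`. -/
def fullRow (α c : ℝ) : Set ℝ := {s | s ∈ Icc 0 3 ∧ α * s + c ∈ Icc 0 3}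

/-- The part of the line `z = α s + c` inside the central square of side one. -/
def centerRow (α c : ℝ) : Set ℝ := {s | s ∈ Ioo 1 2 ∧ α * s + c ∈ Ioo 1 2}

/-- The part of the line `z = α s + c` inside the central cross of `[0,3]²`. -/
def crossRow (α c : ℝ) : Set ℝ := {s | s ∈ fullRow α c ∧ (s ∈ Ioo 1 2 ∨ α * s + c ∈ Ioo 1 2)}

theorem exists_affine_preimages {α : ℝ} (h0 : α ≠ 0) (h1 : |α| ≤ 1) :
    ∃ u w : ℝ, 1 ≤ w ∧ ∀ c s : ℝ,
      (α * s + c ∈ Icc 0 3 ↔ s ∈ Icc (u - c / α) (u - c / α + 3 * w)) ∧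
      (α * s + c ∈ Ioo 1 2 ↔ s ∈ Ioo (u - c / α + w) (u - c / α + 2 * w)) := by
  obtain h | h := h0.lt_or_gt
  · rw [abs_of_neg h] at h1
    refine ⟨3 / α, -1 / α, by rw [le_div_iff_of_neg h]; linarith, fun c s => ?_⟩
    have e1 : 3 / α - c / α = (3 - c) / α := by ring
    have e2 : 3 / α - c / α + 3 * (-1 / α) = (0 - c) / α := by ring
    have e3 : 3 / α - c / α + (-1 / α) = (2 - c) / α := by ring
    have e4 : 3 / α - c / α + 2 * (-1 / α) = (1 - c) / α := by ring
    simp only [e2, e3, e4, mem_Icc, mem_Ioo]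
    rw [e1]
    simp only [div_le_iff_of_neg h, le_div_iff_of_neg h, div_lt_iff_of_neg h, lt_div_iff_of_neg h]
    grind
  · rw [abs_of_pos h] at h1
    refine ⟨0, 1 / α, by rw [le_div_iff₀ h]; linarith, fun c s => ?_⟩
    have e1 : 0 - c / α = (0 - c) / α := by ring
    have e2 : 0 - c / α + 3 * (1 / α) = (3 - c) / α := by ring
    have e3 : 0 - c / α + 1 / α = (1 - c) / α := by ring
    have e4 : 0 - c / α + 2 * (1 / α) = (2 - c) / α := by ring
    simp only [e2, e3, e4, mem_Icc, mem_Ioo]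
    rw [e1]
    simp only [div_le_iff₀ h, le_div_iff₀ h, div_lt_iff₀ h, lt_div_iff₀ h]
    grind

theorem volume_real_rows_le {α c d : ℝ} (h1 : |α| ≤ 1) (hd : |d| ≤ |α|) :
    9 * (volume.real (centerRow α (c + d)) + volume.real (crossRow α c) +
      volume.real (centerRow α (c - d))) ≤
    5 * (volume.real (fullRow α (c + d)) + volume.real (fullRow α c) +
      volume.real (fullRow α (c - d))) := by
  obtain rfl | h0 := eq_or_ne α 0
  · obtain rfl : d = 0 := by simpa using hd
    have hfin : volume (fullRow 0 c) ≠ ∞ :=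
      measure_ne_top_of_subset (fun s hs => hs.1) (measure_Icc_lt_top (a := (0 : ℝ)) (b := 3)).ne
    have hcross : volume.real (crossRow 0 c) ≤ volume.real (fullRow 0 c) :=
      measureReal_mono (fun s hs => hs.1) hfin
    have hcenter : 3 * volume.real (centerRow 0 c) ≤ volume.real (fullRow 0 c) := by
      by_cases hc : c ∈ Ioo 1 2
      · have hc' : c ∈ Icc 0 3 := ⟨by linarith [hc.1], by linarith [hc.2]⟩
        have e1 : centerRow 0 c = Ioo 1 2 := by ext; simp [centerRow, hc.1, hc.2]
        have e2 : fullRow 0 c = Icc 0 3 := by ext; simp [fullRow, hc'.1, hc'.2]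
        rw [e1, e2]
        simp [Real.volume_real_Ioo, Real.volume_real_Icc]
        norm_num
      · have e1 : centerRow 0 c = ∅ := by
          refine eq_empty_of_forall_notMem fun s hs => hc (by simpa using hs.2)
        simp [e1]
    simp only [add_zero, sub_zero]
    linarith
  obtain ⟨u, w, hw, hZ⟩ := exists_affine_preimages h0 h1
  have hfull : ∀ c, volume.real (fullRow α c) =
      max 0 (min 3 ((u - c / α) + 3 * w) - max 0 (u - c / α)) := by
    intro c
    have : fullRow α c = Icc (max 0 (u - c / α)) (min 3 ((u - c / α) + 3 * w)) := by
      rw [← Icc_inter_Icc]; ext s; exact and_congr Iff.rfl (hZ c s).1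
    rw [this, Real.volume_real_Icc, max_comm]
  have hcenter : ∀ c, volume.real (centerRow α c) =
      max 0 (min 2 ((u - c / α) + 2 * w) - max 1 (u - c / α + w)) := by
    intro c
    have : centerRow α c = Ioo (max 1 (u - c / α + w)) (min 2 ((u - c / α) + 2 * w)) := by
      rw [← Ioo_inter_Ioo]; ext s; exact and_congr Iff.rfl (hZ c s).2
    rw [this, Real.volume_real_Ioo, max_comm]
  have hcross : volume.real (crossRow α c) ≤
      max 0 (min 2 (u - c / α + 3 * w) - max 1 (u - c / α)) +
        max 0 (min 3 (u - c / α + 2 * w) - max 0 (u - c / α + w)) -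
        max 0 (min 2 ((u - c / α) + 2 * w) - max 1 (u - c / α + w)) := by
    set a := u - c / α with ha
    have hsub : crossRow α c ⊆
        Icc (max 1 a) (min 2 (a + 3 * w)) ∪ Icc (max 0 (a + w)) (min 3 (a + 2 * w)) := by
      rintro s ⟨⟨hs, hz⟩, h | h⟩
      · rw [(hZ c s).1] at hz
        exact Or.inl ⟨max_le h.1.le hz.1, le_min h.2.le hz.2⟩
      · rw [(hZ c s).2] at h
        exact Or.inr ⟨max_le hs.1 h.1.le, le_min hs.2 h.2.le⟩
    have hinter : Icc (max 1 (a + w)) (min 2 (a + 2 * w)) ⊆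
        Icc (max 1 a) (min 2 (a + 3 * w)) ∩ Icc (max 0 (a + w)) (min 3 (a + 2 * w)) := by
      rintro s ⟨hl, hr⟩
      simp only [max_le_iff, le_min_iff] at hl hr
      exact ⟨⟨max_le (by linarith) (by linarith), le_min (by linarith) (by linarith)⟩,
        ⟨max_le (by linarith) (by linarith), le_min (by linarith) (by linarith)⟩⟩
    have key := measureReal_union_add_inter (μ := volume)
      (s := Icc (max 1 a) (min 2 (a + 3 * w)))
      (measurableSet_Icc (a := max 0 (a + w)) (b := min 3 (a + 2 * w)))
      measure_Icc_lt_top.ne measure_Icc_lt_top.ne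
    have h2 := measureReal_mono (μ := volume) hsub
      (measure_union_lt_top measure_Icc_lt_top measure_Icc_lt_top).ne
    have h3 := measureReal_mono (μ := volume) hinter
      (measure_ne_top_of_subset inter_subset_left measure_Icc_lt_top.ne)
    simp only [Real.volume_real_Icc] at key h3
    simp only [max_comm (0 : ℝ) (_ - _)]
    linarith
  have he : |d / α| ≤ 1 := by
    rw [abs_div]; exact div_le_one_of_le₀ hd (abs_nonneg _)
  rw [hcenter, hcenter, hfull, hfull, hfull]
  have l1 := outerDeficit_le (u := u - (c + d) / α) hw
  have l2 := outerDeficit_le (u := u - (c - d) / α) hw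
  have l3 := middleDeficit_le (u := u - c / α) hw
  have t1 := outerDeficit_add_middleDeficit_nonneg (s := u - c / α) he
  have t2 := outerDeficit_add_middleDeficit_nonneg (s := 3 - (u - c / α) - 3 * w) he
  rw [show u - c / α + d / α = u - (c - d) / α by ring,
    show u - c / α - d / α = u - (c + d) / α by ring] at t1
  rw [show 3 - (u - c / α) - 3 * w + d / α = 3 - (u - (c + d) / α) - 3 * w by ring,
    show 3 - (u - c / α) - 3 * w - d / α = 3 - (u - (c - d) / α) - 3 * w by ring] at t2
  linarith

theorem volume_rows_le {α c d : ℝ} (h1 : |α| ≤ 1) (hd : |d| ≤ |α|) :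
    volume (centerRow α (c + d)) + volume (crossRow α c) + volume (centerRow α (c - d)) ≤
    5 / 9 * (volume (fullRow α (c + d)) + volume (fullRow α c) + volume (fullRow α (c - d))) := by
  have hfin : ∀ A ⊆ Icc (0 : ℝ) 3, volume A = ENNReal.ofReal (volume.real A) := fun A hA =>
    (ofReal_measureReal (measure_ne_top_of_subset hA measure_Icc_lt_top.ne)).symm
  have hcenter : ∀ c, centerRow α c ⊆ Icc 0 3 := fun c s hs =>
    ⟨by linarith [hs.1.1], by linarith [hs.1.2]⟩
  have hfull : ∀ c, fullRow α c ⊆ Icc 0 3 := fun c s hs => hs.1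
  have hcross : ∀ c, crossRow α c ⊆ Icc 0 3 := fun c s hs => hs.1.1
  have h59 : (5 / 9 : ℝ≥0∞) = ENNReal.ofReal (5 / 9) := by
    rw [ENNReal.ofReal_div_of_pos (by norm_num)]; norm_num
  rw [hfin _ (hcenter _), hfin _ (hcenter _), hfin _ (hcross _), hfin _ (hfull _),
    hfin _ (hfull _), hfin _ (hfull _), h59]
  rw [← ENNReal.ofReal_add (by positivity) (by positivity),
    ← ENNReal.ofReal_add (by positivity) (by positivity),
    ← ENNReal.ofReal_add (by positivity) (by positivity),
    ← ENNReal.ofReal_add (by positivity) (by positivity), ← ENNReal.ofReal_mul (by norm_num)]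
  exact ENNReal.ofReal_le_ofReal (by linarith [volume_real_rows_le (c := c) h1 hd])

/-- Parameters in `[0,3]²` over which the plane `z = α s + β t + γ` has height in `[0,3]`. -/
def planarFull (α β γ : ℝ) : Set (ℝ × ℝ) :=
  {p | p.1 ∈ Icc 0 3 ∧ p.2 ∈ fullRow α (β * p.1 + γ)}

/-- Parameters at which at least two of `t`, `s`, `α s + β t + γ` lie in the middle third of
`[0,3]`. -/
def planarRemoved (α β γ : ℝ) : Set (ℝ × ℝ) :=
  {p | p ∈ planarFull α β γ ∧
    (p.1 ∈ Ioo 1 2 ∧ p.2 ∈ crossRow α (β * p.1 + γ) ∨ p.2 ∈ centerRow α (β * p.1 + γ))}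

theorem measurableSet_planarFull (α β γ : ℝ) : MeasurableSet (planarFull α β γ) := by
  have hz : Measurable fun p : ℝ × ℝ => α * p.2 + (β * p.1 + γ) := by fun_prop
  exact (measurable_fst measurableSet_Icc).inter
    ((measurable_snd measurableSet_Icc).inter (hz measurableSet_Icc))

theorem measurableSet_planarRemoved (α β γ : ℝ) : MeasurableSet (planarRemoved α β γ) := by
  have hz : Measurable fun p : ℝ × ℝ => α * p.2 + (β * p.1 + γ) := by fun_prop
  have hs : Measurable (Prod.snd : ℝ × ℝ → ℝ) := measurable_snd
  exact (measurableSet_planarFull α β γ).inter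
    (((measurable_fst measurableSet_Ioo).inter
      (((hs measurableSet_Icc).inter (hz measurableSet_Icc)).inter
        ((hs measurableSet_Ioo).union (hz measurableSet_Ioo)))).union
      ((hs measurableSet_Ioo).inter (hz measurableSet_Ioo)))

theorem volume_planarRemoved_le {α β : ℝ} (γ : ℝ) (hα : |α| ≤ 1) (hβ : |β| ≤ |α|) :
    volume (planarRemoved α β γ) ≤ 5 / 9 * volume (planarFull α β γ) := by
  have hF := measurableSet_planarFull α β γ
  have hR := measurableSet_planarRemoved α β γ
  rw [Measure.volume_eq_prod, Measure.prod_apply hF, Measure.prod_apply hR,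
    lintegral_eq_setLIntegral_add_shifts (measurable_measure_prodMk_left hF),
    lintegral_eq_setLIntegral_add_shifts (measurable_measure_prodMk_left hR),
    ← lintegral_const_mul' _ _ (by finiteness)]
  · refine setLIntegral_mono' measurableSet_Ioo fun t ht => ?_
    have hfull : ∀ t ∈ Icc (0 : ℝ) 3,
        Prod.mk t ⁻¹' planarFull α β γ = fullRow α (β * t + γ) := by
      intro t ht; ext s; simp [planarFull, ht.1, ht.2]
    have hcenter : ∀ t ∉ Ioo (1 : ℝ) 2,
        Prod.mk t ⁻¹' planarRemoved α β γ ⊆ centerRow α (β * t + γ) := by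
      rintro t ht s ⟨-, h | h⟩
      exacts [absurd h.1 ht, h]
    have hcross : Prod.mk (t + 1) ⁻¹' planarRemoved α β γ ⊆ crossRow α (β * (t + 1) + γ) := by
      rintro s ⟨hs, h | h⟩
      exacts [h.2, ⟨hs.2, Or.inl h.1⟩]
    have h0 := ht.1
    have h1 := ht.2
    have key := volume_rows_le (c := β * (t + 1) + γ) (d := -β) hα (by rwa [abs_neg])
    rw [show β * (t + 1) + γ + -β = β * t + γ by ring,
      show β * (t + 1) + γ - -β = β * (t + 2) + γ by ring] at key
    rw [hfull t ⟨by linarith, by linarith⟩, hfull (t + 1) ⟨by linarith, by linarith⟩,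
      hfull (t + 2) ⟨by linarith, by linarith⟩]
    refine le_trans ?_ key
    gcongr
    · exact hcenter t fun h => by linarith [h.1]
    · exact hcenter (t + 2) fun h => by linarith [h.2]
  all_goals
    intro t ht
    refine measure_mono_null (t := ∅) (fun s hs => ht ?_) measure_empty
  · exact hs.1.1
  · exact hs.1

/-- The linear part of `planeParam`. -/
noncomputable def planeDirection (e : Equiv.Perm (Fin 3)) (α β : ℝ) :
    ℝ × ℝ →L[ℝ] EuclideanSpace ℝ (Fin 3) :=
  LinearMap.toContinuousLinearMap
    { toFun := fun p =>
        WithLp.toLp 2 fun l => ![p.1 / 3, p.2 / 3, (α * p.2 + β * p.1) / 3] (e.symm l)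
      map_add' := by
        intro p q
        ext l
        generalize hl : e.symm l = j
        fin_cases j <;> (simp [hl]; ring)
      map_smul' := by
        intro r p
        ext l
        generalize hl : e.symm l = j
        fin_cases j <;> (simp [hl]; ring) }

/-- The parametrization by `[0,3]²`, on coordinates `e 0` and `e 1`, of a plane in `[0,1]³` that is a
graph over these two coordinates. -/
noncomputable def planeParam (e : Equiv.Perm (Fin 3)) (α β γ : ℝ) (p : ℝ × ℝ) :
    EuclideanSpace ℝ (Fin 3) :=
  EuclideanSpace.single (e 2) (γ / 3) + planeDirection e α β p

theorem planeParam_apply (e : Equiv.Perm (Fin 3)) (α β γ : ℝ) (p : ℝ × ℝ) (j : Fin 3) :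
    planeParam e α β γ p (e j) = ![p.1 / 3, p.2 / 3, (α * p.2 + (β * p.1 + γ)) / 3] j := by
  fin_cases j <;> (simp [planeParam, planeDirection]; try ring)

theorem planeDirection_injective (e : Equiv.Perm (Fin 3)) (α β : ℝ) :
    Function.Injective (planeDirection e α β) := by
  intro p q h
  have h0 := congrArg (fun x => x (e 0)) h
  have h1 := congrArg (fun x => x (e 1)) h
  simp [planeDirection] at h0 h1
  ext <;> linarith

theorem exists_two_mid_of_notMem {x : EuclideanSpace ℝ (Fin 3)}
    (hx : x ∈ unitCube \ mengerFirstApprox) :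
    ∃ i j, i ≠ j ∧ x i ∈ Ioo (1 / 3 : ℝ) (2 / 3) ∧ x j ∈ Ioo (1 / 3 : ℝ) (2 / 3) := by
  by_contra! hcon
  obtain ⟨hQ, hM⟩ := hx
  refine hM ⟨fun i => if x i ≤ 1 / 3 then 0 else if 2 / 3 ≤ x i then 2 / 3 else 1 / 3,
    ⟨fun i => ?_, fun hv => ?_⟩, fun i => ?_⟩
  · dsimp only
    split_ifs <;> simp
  · have hmid : ∀ i, (if x i ≤ 1 / 3 then (0 : ℝ) else if 2 / 3 ≤ x i then 2 / 3 else 1 / 3) =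
        1 / 3 → x i ∈ Ioo (1 / 3 : ℝ) (2 / 3) := by
      intro i hi
      split_ifs at hi with h h'
      · norm_num at hi
      · norm_num at hi
      · exact ⟨not_le.1 h, not_le.1 h'⟩
    have h01 := hcon 0 1 (by decide)
    have h02 := hcon 0 2 (by decide)
    have h12 := hcon 1 2 (by decide)
    have k0 := hmid 0
    have k1 := hmid 1
    have k2 := hmid 2
    simp only [removedVecs, mem_insert_iff, mem_singleton_iff, funext_iff, Fin.forall_fin_succ] at hv
    simp at hv
    grind
  · have := hQ i
    dsimp only
    split_ifs with h h'
    · exact ⟨this.1, by linarith⟩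
    · exact ⟨h', by linarith [this.2]⟩
    · exact ⟨(not_le.1 h).le, by linarith [not_le.1 h']⟩

theorem unitCube_inter_eq_image (e : Equiv.Perm (Fin 3)) (α β γ : ℝ) :
    unitCube ∩ {x | α * x (e 1) + β * x (e 0) + γ / 3 = x (e 2)} =
      planeParam e α β γ '' planarFull α β γ := by
  ext x
  constructor
  · rintro ⟨hQ, hx⟩
    simp only [mem_ofPred_eq] at hx
    have h0 := hQ (e 0)
    have h1 := hQ (e 1)
    have h2 := hQ (e 2)
    simp only [mem_Icc] at h0 h1 h2
    refine ⟨(3 * x (e 0), 3 * x (e 1)), ?_, ?_⟩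
    · simp only [planarFull, fullRow, mem_ofPred_eq, mem_Icc]
      refine ⟨⟨?_, ?_⟩, ⟨?_, ?_⟩, ?_, ?_⟩ <;> linarith
    · ext l
      obtain ⟨j, rfl⟩ := e.surjective l
      rw [planeParam_apply]
      fin_cases j <;> (simp; try linarith)
  · rintro ⟨p, ⟨h0, h1, h2⟩, rfl⟩
    simp only [mem_Icc] at h0 h1 h2
    refine ⟨fun l => ?_, ?_⟩
    · obtain ⟨j, rfl⟩ := e.surjective l
      rw [planeParam_apply]
      fin_cases j <;> (simp; constructor <;> linarith)
    · simp only [mem_ofPred_eq, planeParam_apply]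
      simp
      ring

theorem removed_inter_subset_image (e : Equiv.Perm (Fin 3)) (α β γ : ℝ) :
    (unitCube \ mengerFirstApprox) ∩ {x | α * x (e 1) + β * x (e 0) + γ / 3 = x (e 2)} ⊆
      planeParam e α β γ '' planarRemoved α β γ := by
  rintro x ⟨hx, hS⟩
  obtain ⟨p, hp, rfl⟩ := (unitCube_inter_eq_image e α β γ).subset ⟨hx.1, hS⟩
  refine ⟨p, ⟨hp, ?_⟩, rfl⟩
  obtain ⟨i, j, hij, hi, hj⟩ := exists_two_mid_of_notMem hx
  obtain ⟨i, rfl⟩ := e.surjective i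
  obtain ⟨j, rfl⟩ := e.surjective j
  rw [planeParam_apply] at hi hj
  simp only [planarFull, fullRow, crossRow, centerRow, mem_ofPred_eq, mem_Icc, mem_Ioo] at hp ⊢
  fin_cases i <;> fin_cases j <;> simp at hij hi hj <;> grind

theorem hausdorffMeasure_removed_le (e : Equiv.Perm (Fin 3)) {α β : ℝ} (γ : ℝ) (hα : |α| ≤ 1)
    (hβ : |β| ≤ |α|) :
    μH[2] ((unitCube \ mengerFirstApprox) ∩
        {x | α * x (e 1) + β * x (e 0) + γ / 3 = x (e 2)}) ≤
      5 / 9 * μH[2] (unitCube ∩ {x | α * x (e 1) + β * x (e 0) + γ / 3 = x (e 2)}) := by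
  obtain ⟨k, hk⟩ := exists_hausdorffMeasure_image_linearMap_eq_const_mul (planeDirection e α β)
    (planeDirection_injective e α β) (EuclideanSpace.single (e 2) (γ / 3))
  calc _ ≤ μH[2] (planeParam e α β γ '' planarRemoved α β γ) :=
        measure_mono (removed_inter_subset_image e α β γ)
    _ = k * volume (planarRemoved α β γ) := hk _
    _ ≤ k * (5 / 9 * volume (planarFull α β γ)) := by
        gcongr; exact volume_planarRemoved_le γ hα hβ
    _ = 5 / 9 * (k * volume (planarFull α β γ)) := by ring
    _ = _ := by rw [unitCube_inter_eq_image]; exact congrArg _ (hk _).symm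

/-- **Proposition.** For every plane `S(a,b,c)`, the two-dimensional Hausdorff measure of
`(Q \ M₁) ∩ S(a,b,c)` is at most `5/9` times that of `Q ∩ S(a,b,c)`. -/
theorem menger_plane_section_bound (a b c : ℝ) :
    μH[2] ((unitCube \ mengerFirstApprox) ∩ Splane a b c)
      ≤ (5 / 9 : ℝ≥0∞) * μH[2] (unitCube ∩ Splane a b c) := by
  set n : Fin 3 → ℝ := ![a, b, -1] with hn
  set e := Tuple.sort fun i => |n i| with he
  have hmono : Monotone ((fun i => |n i|) ∘ e) := Tuple.monotone_sort _
  have h01 : |n (e 0)| ≤ |n (e 1)| := hmono (by decide)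
  have h12 : |n (e 1)| ≤ |n (e 2)| := hmono (by decide)
  have hpos : 0 < |n (e 2)| := by
    have : |n (e (e.symm 2))| ≤ |n (e 2)| := hmono (Fin.le_last _)
    rw [e.apply_symm_apply] at this
    refine lt_of_lt_of_le ?_ this
    simp [hn]
  have hne : n (e 2) ≠ 0 := abs_pos.1 hpos
  have hS : Splane a b c = {x | -n (e 1) / n (e 2) * x (e 1) + -n (e 0) / n (e 2) * x (e 0) +
      (-3 * c / n (e 2)) / 3 = x (e 2)} := by
    ext x
    have hsum := Equiv.sum_comp e fun i => n i * x i
    have hsum' : ∑ i, n i * x i = a * x 0 + b * x 1 - x 2 := by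
      simp [Fin.sum_univ_three, hn]; ring
    rw [hsum', Fin.sum_univ_three] at hsum
    simp only [Splane, mem_ofPred_eq]
    field_simp
    constructor <;> (intro h; linarith)
  rw [hS]
  refine hausdorffMeasure_removed_le e _ ?_ ?_
  · rw [abs_div, abs_neg]; exact div_le_one_of_le₀ h12 hpos.le
  · rw [abs_div, abs_div, abs_neg, abs_neg]; gcongr
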